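/- arXiv:math/0306034 — 2 statements merged into one kernel-verified Lean document; each statement's English description precedes it below -/
import Mathlib

section
/- Let A be an (n+1)×n integer matrix such that {x ∈ ℝ^n : A x ≤ 0} = {0} and such that every n of its n+1 rows are linearly independent over ℚ. For t ∈ ℤ^{n+1} let S^(t) = {x ∈ ℝ^n : A x ≤ t} (componentwise inequalities), the vector-dilated simplex. Then both lattice-point counting functions are quasipolynomials in t: there exist a positive integer p and two families of polynomials q_r, q'_r ∈ ℚ[x_1, …, x_{n+1}], indexed by residue vectors r ∈ (ℤ/pℤ)^{n+1}, such that for every t ∈ ℤ^{n+1} for which S^(t) has nonempty interior, the number of points of ℤ^n in the interior of S^(t) equals q_{t mod p}(t) and the number of points of ℤ^n in S^(t) equals q'_{t mod p}(t). -/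
open Matrix

/-- Integer data attached to the cone-free matrix `A`: positive weights `c` annihilating `A` on the
left and complementary moduli `d`, such that every `d i • e i` is congruent to `d 0 • e 0` modulo
the lattice `A ℤⁿ`. -/
structure SimplexWeights {n : ℕ} (A : Matrix (Fin (n + 1)) (Fin n) ℤ) where
  /-- The positive left-kernel vector. -/
  c : Fin (n + 1) → ℤ
  /-- The moduli. -/
  d : Fin (n + 1) → ℤ
  /-- The common value of the products `c i * d i`. -/
  period : ℤ
  /-- The lattice vectors realizing the congruences. -/
  v : Fin (n + 1) → Fin n → ℤ
  c_pos : ∀ i, 0 < c i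
  d_pos : ∀ i, 0 < d i
  c_mul_d : ∀ i, c i * d i = period
  c_dot : ∀ x, c ⬝ᵥ (A *ᵥ x) = 0
  mulVec_v : ∀ i, A *ᵥ v i = Pi.single i (d i) - Pi.single 0 (d 0)

theorem nonempty_simplexWeights {n : ℕ} (A : Matrix (Fin (n + 1)) (Fin n) ℤ)
    (hA : ∀ x, A *ᵥ x ≤ 0 → x = 0) (hdet : (A.submatrix Fin.succ id).det ≠ 0) :
    Nonempty (SimplexWeights A) := by
  set B := A.submatrix Fin.succ id with hB
  set δ := B.det with hδ
  let col : Fin n → Fin n → ℤ := fun i k => B.adjugate k i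
  let β : Fin n → ℤ := fun i => (A *ᵥ col i) 0
  have hsucc : ∀ i k, (A *ᵥ col i) (Fin.succ k) = if k = i then δ else 0 := by
    intro i k
    have h := congrFun (congrFun (mul_adjugate B) k) i
    simpa [Matrix.mul_apply, Matrix.one_apply, mulVec, dotProduct, hB, col, hδ] using h
  have hβ : ∀ i, 0 < -(δ * β i) := by
    intro i
    by_contra hneg
    have hle : A *ᵥ ((-δ) • col i) ≤ 0 := by
      rw [mulVec_smul]
      intro k
      refine Fin.cases ?_ (fun k => ?_) k
      · simp only [Pi.smul_apply, smul_eq_mul, Pi.zero_apply]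
        change -δ * β i ≤ 0
        linarith
      · simp only [Pi.smul_apply, smul_eq_mul, Pi.zero_apply, hsucc]
        split_ifs
        · nlinarith [mul_self_nonneg δ]
        · simp
    have h0 := hA _ hle
    have h1 : (A *ᵥ ((-δ) • col i)) i.succ = 0 := by rw [h0]; simp
    rw [mulVec_smul] at h1
    simp [hsucc, hdet] at h1
  have hrow : ∀ k, δ * A 0 k = ∑ i, β i * A i.succ k := by
    intro k
    have h : (A.row 0) ᵥ* (B.adjugate * B) = δ • A.row 0 := by
      rw [adjugate_mul, vecMul_smul, vecMul_one]
    rw [← vecMul_vecMul] at h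
    exact (congrFun h k).symm
  let c' : Fin n → ℤ := fun i => -(δ * β i)
  let κ : Fin n → ℤ := fun i => δ * ∏ j ∈ Finset.univ.erase i, c' j
  have hprod : ∀ i, c' i * ∏ j ∈ Finset.univ.erase i, c' j = ∏ j, c' j := fun i =>
    Finset.mul_prod_erase _ _ (Finset.mem_univ i)
  have hδ2 : 0 < δ * δ := mul_self_pos.mpr hdet
  have hpos : ∀ s : Finset (Fin n), 0 < ∏ j ∈ s, c' j := fun s =>
    Finset.prod_pos fun j _ => hβ j
  refine ⟨⟨Fin.cons (δ * δ) c', Fin.cons (∏ j, c' j) (fun i => κ i * δ),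
    δ * δ * ∏ j, c' j, Fin.cons 0 (fun i => κ i • col i), ?_, ?_, ?_, ?_, ?_⟩⟩
  · exact Fin.cases hδ2 hβ
  · refine Fin.cases (by rw [Fin.cons_zero]; exact hpos _) (fun i => ?_)
    simp only [Fin.cons_succ, κ]
    nlinarith [mul_pos hδ2 (hpos (Finset.univ.erase i))]
  · refine Fin.cases rfl (fun i => ?_)
    simp only [Fin.cons_succ, κ, ← hprod i]
    ring
  · intro x
    rw [dotProduct_mulVec]
    suffices h : (Fin.cons (δ * δ) c' : Fin (n + 1) → ℤ) ᵥ* A = 0 by simp [h]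
    ext k
    simp only [vecMul, dotProduct, Fin.sum_univ_succ, Fin.cons_zero, Fin.cons_succ, c',
      Pi.zero_apply, mul_assoc, hrow k, Finset.mul_sum, neg_mul, Finset.sum_neg_distrib]
    ring
  · refine Fin.cases (by simp) (fun i => ?_)
    ext k
    refine Fin.cases ?_ (fun k => ?_) k
    · simp only [Fin.cons_succ, Fin.cons_zero, mulVec_smul, Pi.smul_apply, smul_eq_mul,
        Pi.sub_apply, Pi.single_eq_same, κ, ← hprod i]
      change _ * β i = _
      simp [c']
      ring
    · simp only [Fin.cons_succ, mulVec_smul, Pi.smul_apply, smul_eq_mul, hsucc, Pi.sub_apply]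
      simp [Pi.single_apply]

theorem ncard_sum_eq_nat (n K : ℕ) :
    {k : Fin (n + 1) → ℕ | ∑ i, k i = K}.ncard = (K + n).choose n := by
  rw [← Nat.card_coe_set_eq]
  change Nat.card {k : Fin (n + 1) → ℕ // ∑ i, k i = K} = _
  rw [← Nat.card_congr (Sym.equivNatSumOfFintype (Fin (n + 1)) K), Nat.card_eq_fintype_card,
    Sym.card_sym_eq_multichoose, Fintype.card_fin, Nat.multichoose_eq,
    show n + 1 + K - 1 = K + n by omega, Nat.choose_symm_add]

theorem finite_sum_eq (n : ℕ) (K : ℤ) : {k : Fin (n + 1) → ℕ | ∑ i, (k i : ℤ) = K}.Finite := by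
  refine (Set.finite_Iic (fun _ => K.toNat)).subset fun k hk i => ?_
  have h := Finset.single_le_sum (f := fun i => (k i : ℤ)) (fun i _ => by positivity)
    (Finset.mem_univ i)
  simp only [Set.mem_ofPred_eq] at hk
  change k i ≤ K.toNat
  omega

/-- The number of compositions of `K` into `n + 1` natural numbers is given by a polynomial in `K`
that stays valid for the negative values `-n ≤ K < 0`. -/
theorem ncard_sum_eq (n : ℕ) (K : ℤ) (hK : -(n : ℤ) ≤ K) :
    ({k : Fin (n + 1) → ℕ | ∑ i, (k i : ℤ) = K}.ncard : ℚ) =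
      (∏ j ∈ Finset.range n, ((K : ℚ) + (j + 1))) * (n.factorial : ℚ)⁻¹ := by
  rcases le_or_gt 0 K with h | h
  · lift K to ℕ using h
    have hs : {k : Fin (n + 1) → ℕ | ∑ i, (k i : ℤ) = K} = {k | ∑ i, k i = K} := by
      ext k
      simp only [Set.mem_ofPred_eq]
      norm_cast
    rw [hs, ncard_sum_eq_nat]
    have h := Nat.ascFactorial_eq_factorial_mul_choose K n
    rw [Nat.ascFactorial_eq_prod_range] at h
    have h' : ∏ j ∈ Finset.range n, (((K : ℤ) : ℚ) + (j + 1)) =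
        n.factorial * (K + n).choose n := by
      rw [← Nat.cast_mul, ← h]
      push_cast
      exact Finset.prod_congr rfl fun j _ => by ring
    rw [h', mul_comm (n.factorial : ℚ),
      mul_inv_cancel_right₀ (Nat.cast_ne_zero.mpr n.factorial_ne_zero)]
  · have hs : {k : Fin (n + 1) → ℕ | ∑ i, (k i : ℤ) = K} = ∅ := by
      ext k
      simp only [Set.mem_ofPred_eq, Set.mem_empty_iff_false, iff_false]
      have : 0 ≤ ∑ i, (k i : ℤ) := by positivity
      omega
    have hm : (-K - 1).toNat ∈ Finset.range n := by
      rw [Finset.mem_range]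
      omega
    rw [hs, Finset.prod_eq_zero hm]
    · simp
    · have : (((-K - 1).toNat : ℤ) : ℚ) = -K - 1 := by
        rw [Int.toNat_of_nonneg (by omega)]
        push_cast
        ring
      rw [← Int.cast_natCast, this]
      ring

namespace SimplexWeights

variable {n : ℕ} {A : Matrix (Fin (n + 1)) (Fin n) ℤ} (w : SimplexWeights A)

theorem mulVec_sum_v (k : Fin (n + 1) → ℤ) :
    A *ᵥ (∑ i, k i • w.v i) = k * w.d - Pi.single 0 ((∑ i, k i) * w.d 0) := by
  rw [mulVec_sum]
  simp only [mulVec_smul, w.mulVec_v, smul_sub, Finset.sum_sub_distrib]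
  congr 1
  · ext j
    simp [Finset.sum_apply, Pi.single_apply]
  · ext j
    simp [Finset.sum_apply, Pi.single_apply, Finset.sum_mul]

/-- The vector `s` lies in the full-rank lattice generated by `A ℤⁿ` and `d 0 • e 0`, the
coefficient of the last generator being `K`. -/
def Rep (s : Fin (n + 1) → ℤ) (K : ℤ) : Prop :=
  ∃ y, s = A *ᵥ y + Pi.single 0 (K * w.d 0)

theorem Rep.add {s s' : Fin (n + 1) → ℤ} {K K' : ℤ} (h : w.Rep s K) (h' : w.Rep s' K') :
    w.Rep (s + s') (K + K') := by
  obtain ⟨y, rfl⟩ := h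
  obtain ⟨y', rfl⟩ := h'
  refine ⟨y + y', ?_⟩
  rw [mulVec_add, add_mul, Pi.single_add]
  abel

theorem rep_mul_d (k : Fin (n + 1) → ℤ) : w.Rep (k * w.d) (∑ i, k i) :=
  ⟨∑ i, k i • w.v i, by rw [w.mulVec_sum_v]; abel⟩

theorem rep_mulVec (x : Fin n → ℤ) : w.Rep (A *ᵥ x) 0 := ⟨x, by simp⟩

theorem Rep.dot {s : Fin (n + 1) → ℤ} {K : ℤ} (h : w.Rep s K) : w.c ⬝ᵥ s = K * w.period := by
  obtain ⟨y, rfl⟩ := h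
  rw [dotProduct_add, w.c_dot, dotProduct_single, ← w.c_mul_d 0]
  ring

theorem period_pos : 0 < w.period := w.c_mul_d 0 ▸ mul_pos (w.c_pos 0) (w.d_pos 0)

/-- Lattice points of the dilated simplex whose slack vector has residues `r` modulo `d`. -/
def fiber (t r : Fin (n + 1) → ℤ) : Set (Fin n → ℤ) :=
  {x | A *ᵥ x ≤ t ∧ (fun i => (t i - (A *ᵥ x) i) % w.d i) = r}

theorem exists_slack_of_mem_fiber {t r : Fin (n + 1) → ℤ} {x : Fin n → ℤ} (hx : x ∈ w.fiber t r) :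
    ∃ k : Fin (n + 1) → ℕ, t = A *ᵥ x + r + (fun i => (k i : ℤ)) * w.d := by
  obtain ⟨hle, hmod⟩ := hx
  refine ⟨fun i => ((t i - (A *ᵥ x) i) / w.d i).toNat, ?_⟩
  ext i
  have h1 : (t i - (A *ᵥ x) i) % w.d i = r i := congrFun hmod i
  have h2 := Int.emod_add_mul_ediv (t i - (A *ᵥ x) i) (w.d i)
  have h3 : 0 ≤ (t i - (A *ᵥ x) i) / w.d i :=
    Int.ediv_nonneg (sub_nonneg.mpr (hle i)) (w.d_pos i).le
  simp only [Pi.add_apply, Pi.mul_apply, Int.toNat_of_nonneg h3]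
  linarith

theorem rep_of_mem_fiber {t r : Fin (n + 1) → ℤ} {x : Fin n → ℤ} (hx : x ∈ w.fiber t r) :
    ∃ K, w.Rep (t - r) K := by
  obtain ⟨k, hk⟩ := w.exists_slack_of_mem_fiber hx
  rw [show t - r = A *ᵥ x + (fun i => (k i : ℤ)) * w.d by rw [hk]; abel]
  exact ⟨_, Rep.add w (w.rep_mulVec x) (w.rep_mul_d _)⟩

theorem fiber_eq_image (hA : Function.Injective (A *ᵥ ·)) {t r : Fin (n + 1) → ℤ} {y : Fin n → ℤ}
    {K : ℤ} (h : t - r = A *ᵥ y + Pi.single 0 (K * w.d 0)) (hr : ∀ i, 0 ≤ r i ∧ r i < w.d i) :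
    w.fiber t r = (fun k : Fin (n + 1) → ℕ => y - ∑ i, (k i : ℤ) • w.v i) ''
      {k | ∑ i, (k i : ℤ) = K} := by
  ext x
  constructor
  · intro hx
    obtain ⟨k, hk⟩ := w.exists_slack_of_mem_fiber hx
    have hrep : w.Rep (t - r) (0 + ∑ i, (k i : ℤ)) := by
      rw [show t - r = A *ᵥ x + (fun i => (k i : ℤ)) * w.d by rw [hk]; abel]
      exact Rep.add w (w.rep_mulVec x) (w.rep_mul_d _)
    have hK : ∑ i, (k i : ℤ) = K := by
      have h1 := hrep.dot
      rw [Rep.dot w ⟨y, h⟩, zero_add] at h1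
      exact (mul_right_cancel₀ w.period_pos.ne' h1).symm
    refine ⟨k, hK, hA ?_⟩
    simp only [mulVec_sub]
    rw [w.mulVec_sum_v (fun i => (k i : ℤ)), hK]
    have h2 : A *ᵥ y = t - r - Pi.single 0 (K * w.d 0) := by rw [h]; abel
    rw [h2, hk]
    abel
  · rintro ⟨k, hK, rfl⟩
    simp only [Set.mem_ofPred_eq] at hK
    have hs : ∀ i, t i - (A *ᵥ (y - ∑ i, (k i : ℤ) • w.v i)) i = r i + w.d i * k i := by
      intro i
      have h2 : A *ᵥ y = t - r - Pi.single 0 (K * w.d 0) := by rw [h]; abel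
      rw [mulVec_sub, w.mulVec_sum_v (fun i => (k i : ℤ)), hK, h2]
      simp only [Pi.sub_apply, Pi.mul_apply]
      ring
    refine ⟨fun i => ?_, funext fun i => ?_⟩
    · rw [← sub_nonneg, hs i]
      exact add_nonneg (hr i).1 (mul_nonneg (w.d_pos i).le (Int.natCast_nonneg _))
    · rw [hs i, Int.add_mul_emod_self_left, Int.emod_eq_of_lt (hr i).1 (hr i).2]

theorem injOn_sub_sum_v (y : Fin n → ℤ) (K : ℤ) :
    Set.InjOn (fun k : Fin (n + 1) → ℕ => y - ∑ i, (k i : ℤ) • w.v i)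
      {k | ∑ i, (k i : ℤ) = K} := by
  intro k hk l hl hkl
  simp only [Set.mem_ofPred_eq] at hk hl
  have h := congrArg (A *ᵥ ·) (sub_right_injective hkl)
  rw [w.mulVec_sum_v (fun i => (k i : ℤ)), w.mulVec_sum_v (fun i => (l i : ℤ)), hk, hl] at h
  ext i
  have hi := congrFun (sub_left_injective h) i
  exact Int.ofNat_inj.mp (mul_right_cancel₀ (w.d_pos i).ne' hi)

theorem finite_fiber (hA : Function.Injective (A *ᵥ ·)) {t r : Fin (n + 1) → ℤ}
    (hr : ∀ i, 0 ≤ r i ∧ r i < w.d i) : (w.fiber t r).Finite := by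
  rcases (w.fiber t r).eq_empty_or_nonempty with h | ⟨x, hx⟩
  · rw [h]
    exact Set.finite_empty
  · obtain ⟨K, y, hy⟩ := w.rep_of_mem_fiber hx
    rw [w.fiber_eq_image hA hy hr]
    exact (finite_sum_eq n K).image _

/-- The polynomial expressing the size of a nonempty fiber in terms of `t`. -/
noncomputable def fiberPoly (r : Fin (n + 1) → ℤ) : MvPolynomial (Fin (n + 1)) ℚ :=
  (∏ j ∈ Finset.range n, (MvPolynomial.C (w.period : ℚ)⁻¹ *
    (∑ i, MvPolynomial.C (w.c i : ℚ) * (MvPolynomial.X i - MvPolynomial.C (r i : ℚ))) +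
      MvPolynomial.C ((j : ℚ) + 1))) * MvPolynomial.C (n.factorial : ℚ)⁻¹

theorem ncard_fiber (hA : Function.Injective (A *ᵥ ·)) {t r : Fin (n + 1) → ℤ} {K : ℤ}
    (h : w.Rep (t - r) K) (hr : ∀ i, 0 ≤ r i ∧ r i < w.d i) (ht : -∑ i, w.c i < w.c ⬝ᵥ t) :
    ((w.fiber t r).ncard : ℚ) = MvPolynomial.eval (fun i => (t i : ℚ)) (w.fiberPoly r) := by
  have hdot := h.dot
  obtain ⟨y, hy⟩ := h
  have hcr : w.c ⬝ᵥ r ≤ (n + 1) * w.period - ∑ i, w.c i := by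
    calc w.c ⬝ᵥ r ≤ ∑ i, (w.period - w.c i) := by
          refine Finset.sum_le_sum fun i _ => ?_
          rw [← w.c_mul_d i]
          nlinarith [w.c_pos i, (hr i).2]
      _ = _ := by simp
  have hK : -(n : ℤ) ≤ K := by
    rw [dotProduct_sub] at hdot
    have : -((n : ℤ) + 1) * w.period < K * w.period := by linarith
    have := lt_of_mul_lt_mul_right this w.period_pos.le
    omega
  rw [w.fiber_eq_image hA hy hr, (w.injOn_sub_sum_v y K).ncard_image, ncard_sum_eq n K hK]
  have hP : (w.period : ℚ) ≠ 0 := Int.cast_ne_zero.mpr w.period_pos.ne'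
  have hKq : (w.period : ℚ)⁻¹ * ∑ i, (w.c i : ℚ) * ((t i : ℚ) - r i) = K := by
    rw [inv_mul_eq_iff_eq_mul₀ hP, mul_comm]
    exact_mod_cast hdot
  simp only [fiberPoly, map_mul, MvPolynomial.eval_prod, map_add, map_sum, map_sub,
    MvPolynomial.eval_C, MvPolynomial.eval_X, hKq]

/-- The box of possible residues of the slack vector modulo `d`. -/
noncomputable def box : Finset (Fin (n + 1) → ℤ) := Fintype.piFinset fun i => Finset.Ico 0 (w.d i)

theorem mem_box {r : Fin (n + 1) → ℤ} : r ∈ w.box ↔ ∀ i, 0 ≤ r i ∧ r i < w.d i := by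
  simp [box]

theorem ncard_eq_sum_fiber (hA : Function.Injective (A *ᵥ ·)) (t : Fin (n + 1) → ℤ) :
    {x | A *ᵥ x ≤ t}.ncard = ∑ r ∈ w.box, (w.fiber t r).ncard := by
  classical
  have hmaps : ∀ x, (fun i => (t i - (A *ᵥ x) i) % w.d i) ∈ w.box := fun x =>
    w.mem_box.mpr fun i => ⟨Int.emod_nonneg _ (w.d_pos i).ne', Int.emod_lt_of_pos _ (w.d_pos i)⟩
  have hfin : {x | A *ᵥ x ≤ t}.Finite := by
    refine (w.box.finite_toSet.biUnion fun r hr => w.finite_fiber (t := t) hA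
      (w.mem_box.mp hr)).subset fun x hx => ?_
    exact Set.mem_biUnion (hmaps x) ⟨hx, rfl⟩
  rw [Set.ncard_eq_toFinset_card _ hfin,
    Finset.card_eq_sum_card_fiberwise (fun x _ => hmaps x)]
  refine Finset.sum_congr rfl fun r _ => ?_
  rw [← Set.ncard_coe_finset]
  congr 1
  ext x
  simp [fiber]

theorem rep_of_modEq {s s' : Fin (n + 1) → ℤ} (h : ∀ i, s i ≡ s' i [ZMOD w.period]) {K : ℤ}
    (hs : w.Rep s K) : ∃ K', w.Rep s' K' := by
  choose u hu using fun i => (h i).dvd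
  have hs' : s' = s + (w.c * u) * w.d := by
    ext i
    simp only [Pi.add_apply, Pi.mul_apply]
    linear_combination hu i - u i * w.c_mul_d i
  exact ⟨_, hs' ▸ Rep.add w hs (w.rep_mul_d _)⟩

open Classical in
/-- The constituents of the quasipolynomial counting lattice points. -/
noncomputable def constituent (ρ : Fin (n + 1) → ZMod w.period.toNat) :
    MvPolynomial (Fin (n + 1)) ℚ :=
  ∑ r ∈ w.box, if ∃ s : Fin (n + 1) → ℤ, (fun i => (s i : ZMod w.period.toNat)) = ρ ∧
    ∃ K, w.Rep (s - r) K then w.fiberPoly r else 0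

theorem ncard_eq_eval_constituent (hA : Function.Injective (A *ᵥ ·)) (t : Fin (n + 1) → ℤ)
    (ht : -∑ i, w.c i < w.c ⬝ᵥ t) :
    ({x | A *ᵥ x ≤ t}.ncard : ℚ) =
      MvPolynomial.eval (fun i => (t i : ℚ)) (w.constituent fun i => (t i : ZMod _)) := by
  rw [w.ncard_eq_sum_fiber hA, constituent, map_sum, Nat.cast_sum]
  refine Finset.sum_congr rfl fun r hr => ?_
  rw [mem_box] at hr
  split_ifs with h
  · obtain ⟨s, hs, K, hK⟩ := h
    obtain ⟨K', hK'⟩ : ∃ K', w.Rep (t - r) K' := by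
      refine w.rep_of_modEq (fun i => ?_) hK
      have h1 := (ZMod.intCast_eq_intCast_iff _ _ _).mp (congrFun hs i)
      rw [Int.toNat_of_nonneg w.period_pos.le] at h1
      exact h1.sub_right _
    exact w.ncard_fiber hA hK' hr ht
  · have hempty : w.fiber t r = ∅ := by
      rw [Set.eq_empty_iff_forall_notMem]
      exact fun x hx => h ⟨t, rfl, w.rep_of_mem_fiber hx⟩
    simp [hempty]

end SimplexWeights

theorem det_submatrix_succ_ne_zero {n : ℕ} (A : Matrix (Fin (n + 1)) (Fin n) ℤ)
    (h : LinearIndependent ℚ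
      (fun j : {j : Fin (n + 1) // j ≠ 0} => fun k => (A j.1 k : ℚ))) :
    (A.submatrix Fin.succ id).det ≠ 0 := by
  have hli : LinearIndependent ℚ ((A.submatrix Fin.succ id).map (Int.cast : ℤ → ℚ)).row :=
    h.comp (fun i : Fin n => ⟨i.succ, Fin.succ_ne_zero i⟩) fun i j hij =>
      Fin.succ_injective _ (congrArg Subtype.val hij)
  rw [linearIndependent_rows_iff_isUnit, isUnit_iff_isUnit_det, isUnit_iff_ne_zero] at hli
  intro h0
  apply hli
  have hmap := (Int.castRingHom ℚ).map_det (A.submatrix Fin.succ id)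
  rw [h0, map_zero] at hmap
  exact hmap.symm

theorem interior_setOf_forall_sum_le {ι κ : Type*} [Finite ι] [Fintype κ] (a : ι → κ → ℝ)
    (ha : ∀ i, a i ≠ 0) (t : ι → ℝ) :
    interior {x : κ → ℝ | ∀ i, ∑ j, a i j * x j ≤ t i} = {x | ∀ i, ∑ j, a i j * x j < t i} := by
  classical
  let f : ι → (κ → ℝ) →ₗ[ℝ] ℝ := fun i => dotProductBilin ℝ ℝ (a i)
  have hf : ∀ i x, f i x = ∑ j, a i j * x j := fun i x => rfl
  have hsurj : ∀ i, Function.Surjective (f i) := by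
    intro i
    refine LinearMap.surjective fun h0 => ha i (funext fun j => ?_)
    have := hf i (Pi.single j 1)
    rw [h0] at this
    simpa [Pi.single_apply] using this.symm
  have hset : {x : κ → ℝ | ∀ i, ∑ j, a i j * x j ≤ t i} = ⋂ i, f i ⁻¹' Set.Iic (t i) := by
    ext x
    simp [hf]
  rw [hset, interior_iInter_of_finite]
  ext x
  simp only [← ((f _).isOpenMap_of_finiteDimensional (hsurj _)).preimage_interior_eq_interior_preimage
    (f _).continuous_of_finiteDimensional, interior_Iic]
  simp [hf]

theorem row_ne_zero {n : ℕ} (hn : n ≠ 0) {A : Matrix (Fin (n + 1)) (Fin n) ℤ}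
    (hind : ∀ i : Fin (n + 1),
      LinearIndependent ℚ (fun j : {j : Fin (n + 1) // j ≠ i} => fun k => (A j.1 k : ℚ)))
    (i : Fin (n + 1)) : (fun k => (A i k : ℝ)) ≠ 0 := by
  have : Nontrivial (Fin (n + 1)) := Fin.nontrivial_iff_two_le.mpr (by omega)
  obtain ⟨l, hl⟩ := exists_ne i
  intro h
  refine (hind l).ne_zero ⟨i, hl.symm⟩ (funext fun k => ?_)
  have hk : (A i k : ℝ) = 0 := congrFun h k
  simpa using hk

/-- **Quasipolynomiality of lattice-point counts of vector-dilated simplices.**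
Let `A` be an `(n+1) × n` integer matrix with `{x : A x ≤ 0} = {0}` and every `n` of
whose `n+1` rows are linearly independent over `ℚ`.  For `t ∈ ℤ^{n+1}` let
`S^(t) = {x ∈ ℝⁿ : A x ≤ t}`.  Then there are a positive integer `p` and families of
polynomials `q_r, q'_r ∈ ℚ[x₁,…,x_{n+1}]`, indexed by `r ∈ (ℤ/p)^{n+1}`, such that
for every `t` for which `S^(t)` has nonempty interior, the number of lattice points
in the interior of `S^(t)` is `q_{t mod p}(t)` and the number of lattice points in
`S^(t)` is `q'_{t mod p}(t)`. -/
theorem vector_dilated_simplex_quasipolynomial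
    (n : ℕ) (A : Matrix (Fin (n + 1)) (Fin n) ℤ)
    (hbdd : {x : Fin n → ℝ | ∀ i, (∑ j, (A i j : ℝ) * x j) ≤ 0} = {0})
    (hind : ∀ i : Fin (n + 1),
      LinearIndependent ℚ (fun j : {j : Fin (n + 1) // j ≠ i} => fun k => (A j.1 k : ℚ))) :
    ∃ p : ℕ, 0 < p ∧
      ∃ q q' : (Fin (n + 1) → ZMod p) → MvPolynomial (Fin (n + 1)) ℚ,
        ∀ t : Fin (n + 1) → ℤ,
          (interior {x : Fin n → ℝ | ∀ i, (∑ j, (A i j : ℝ) * x j) ≤ (t i : ℝ)}).Nonempty →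
          (({x : Fin n → ℤ |
              (fun i => (x i : ℝ)) ∈
                interior {x : Fin n → ℝ | ∀ i, (∑ j, (A i j : ℝ) * x j) ≤ (t i : ℝ)}}.ncard : ℚ)
            = MvPolynomial.eval (fun i => (t i : ℚ)) (q fun i => (t i : ZMod p))) ∧
          (({x : Fin n → ℤ | ∀ i, (∑ j, A i j * x j) ≤ t i}.ncard : ℚ)
            = MvPolynomial.eval (fun i => (t i : ℚ)) (q' fun i => (t i : ZMod p))) := by
  have hcone : ∀ x, A *ᵥ x ≤ 0 → x = 0 := by
    intro x hx
    have hmem : (fun j => (x j : ℝ)) ∈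
        {x : Fin n → ℝ | ∀ i, (∑ j, (A i j : ℝ) * x j) ≤ 0} := fun i => by
      have hi : ∑ j, A i j * x j ≤ 0 := hx i
      beta_reduce
      exact_mod_cast hi
    rw [hbdd] at hmem
    exact funext fun j => Int.cast_eq_zero.mp (congrFun hmem j)
  have hinj : Function.Injective (A *ᵥ ·) := fun x y hxy =>
    sub_eq_zero.mp (hcone _ (by rw [mulVec_sub]; exact (sub_eq_zero.mpr hxy).le))
  obtain ⟨w⟩ := nonempty_simplexWeights A hcone (det_submatrix_succ_ne_zero A (hind 0))
  have hc : ∀ x : Fin n → ℝ, ∑ i, (w.c i : ℝ) * ∑ j, (A i j : ℝ) * x j = 0 := by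
    intro x
    simp only [Finset.mul_sum]
    rw [Finset.sum_comm]
    refine Finset.sum_eq_zero fun j _ => ?_
    simp only [← mul_assoc, ← Finset.sum_mul]
    have h := w.c_dot (Pi.single j 1)
    rw [mulVec_single_one] at h
    have h' : ∑ i, (w.c i : ℝ) * A i j = 0 := by exact_mod_cast h
    rw [h', zero_mul]
  have hclosed : ∀ t : Fin (n + 1) → ℤ,
      (interior {x : Fin n → ℝ | ∀ i, (∑ j, (A i j : ℝ) * x j) ≤ (t i : ℝ)}).Nonempty →
      ({x : Fin n → ℤ | ∀ i, (∑ j, A i j * x j) ≤ t i}.ncard : ℚ) =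
        MvPolynomial.eval (fun i => (t i : ℚ)) (w.constituent fun i => (t i : ZMod _)) := by
    rintro t ⟨x, hx⟩
    refine w.ncard_eq_eval_constituent hinj t ?_
    have hle : (0 : ℝ) ≤ ∑ i, (w.c i : ℝ) * t i := by
      rw [← hc x]
      exact Finset.sum_le_sum fun i _ =>
        mul_le_mul_of_nonneg_left (interior_subset hx i) (by exact_mod_cast (w.c_pos i).le)
    have hle' : 0 ≤ w.c ⬝ᵥ t := by
      simp only [dotProduct]
      exact_mod_cast hle
    have hsum : 0 < ∑ i, w.c i := Finset.sum_pos (fun i _ => w.c_pos i) Finset.univ_nonempty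
    linarith
  refine ⟨w.period.toNat, by have := w.period_pos; omega, ?_⟩
  rcases eq_or_ne n 0 with rfl | hn
  · refine ⟨w.constituent, w.constituent, fun t ht => ⟨?_, hclosed t ht⟩⟩
    rw [← hclosed t ht]
    obtain ⟨x, hx⟩ := ht
    congr 2
    ext y
    simp only [Set.mem_ofPred_eq, Subsingleton.elim (fun i => (y i : ℝ)) x, hx, true_iff]
    intro i
    have := interior_subset hx i
    simp only [Finset.univ_eq_empty, Finset.sum_empty] at this ⊢
    exact_mod_cast this
  · refine ⟨fun ρ => MvPolynomial.bind₁ (fun i => MvPolynomial.X i - 1)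
      (w.constituent fun i => ρ i - 1), w.constituent, fun t ht => ⟨?_, hclosed t ht⟩⟩
    rw [interior_setOf_forall_sum_le (fun i j => (A i j : ℝ)) (row_ne_zero hn hind)] at ht ⊢
    obtain ⟨x, hx⟩ := ht
    have hlt : (0 : ℝ) < ∑ i, (w.c i : ℝ) * t i := by
      rw [← hc x]
      exact Finset.sum_lt_sum_of_nonempty Finset.univ_nonempty fun i _ =>
        mul_lt_mul_of_pos_left (hx i) (by exact_mod_cast w.c_pos i)
    have hlt' : 0 < w.c ⬝ᵥ t := by
      simp only [dotProduct]
      exact_mod_cast hlt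
    have h := w.ncard_eq_eval_constituent hinj (t - 1) (by
      rw [dotProduct_sub, dotProduct_one]
      linarith)
    have hset : {y : Fin n → ℤ | (fun i => (y i : ℝ)) ∈
        {x : Fin n → ℝ | ∀ i, ∑ j, (A i j : ℝ) * x j < t i}} = {y | A *ᵥ y ≤ t - 1} := by
      ext y
      simp only [Set.mem_ofPred_eq, Pi.le_def, Pi.sub_apply, Pi.one_apply, Int.le_sub_one_iff]
      exact forall_congr' fun i => by
        simp only [mulVec, dotProduct]
        exact_mod_cast Iff.rfl
    rw [hset, h]
    simp only [MvPolynomial.eval, MvPolynomial.eval₂Hom_bind₁]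
    simp
end

section
/- Ehrhart-type reciprocity for vector-dilated simplices: Let A be an (n+1)×n integer matrix such that {x ∈ ℝ^n : A x ≤ 0} = {0} and such that every n of its n+1 rows are linearly independent over ℚ. For t ∈ ℤ^{n+1} let S^(t) = {x ∈ ℝ^n : A x ≤ t}. Then there exist a positive integer p and a family of polynomials q_r ∈ ℚ[x_1, …, x_{n+1}], indexed by residue vectors r ∈ (ℤ/pℤ)^{n+1}, such that for every t ∈ ℤ^{n+1} for which S^(t) has nonempty interior: the number of points of ℤ^n in the interior of S^(t) equals q_{t mod p}(t), and the number of points of ℤ^n in S^(t) equals (-1)^n · q_{(-t) mod p}(-t). -/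
open Matrix

lemma eq_zero_of_vecMul_eq_zero {n : ℕ} {A : Matrix (Fin (n + 1)) (Fin n) ℤ}
    (hind : ∀ i : Fin (n + 1),
      LinearIndependent ℚ (fun j : {j : Fin (n + 1) // j ≠ i} => fun k => (A j.1 k : ℚ)))
    {l : Fin (n + 1) → ℤ} (hl : l ᵥ* A = 0) {i : Fin (n + 1)} (hi : l i = 0) : l = 0 := by
  have h := Fintype.linearIndependent_iff.1 (hind i) (fun j => (l j.1 : ℚ)) (by
    ext k
    have hk := congrFun hl k
    simp only [vecMul, dotProduct, Pi.zero_apply] at hk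
    rw [Fintype.sum_eq_add_sum_subtype_ne _ i, hi, zero_mul, zero_add] at hk
    simpa [Finset.sum_apply] using congrArg (Int.cast : ℤ → ℚ) hk)
  ext j
  by_cases hj : j = i
  · rw [hj, hi]; rfl
  · exact_mod_cast h ⟨j, hj⟩

/-- The rows of `A` satisfy an integral relation with nonzero coefficients. -/
lemma exists_relation {n : ℕ} {A : Matrix (Fin (n + 1)) (Fin n) ℤ}
    (hind : ∀ i : Fin (n + 1),
      LinearIndependent ℚ (fun j : {j : Fin (n + 1) // j ≠ i} => fun k => (A j.1 k : ℚ))) :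
    ∃ l : Fin (n + 1) → ℤ, (∀ i, l i ≠ 0) ∧ l ᵥ* A = 0 := by
  obtain ⟨l, hl, hlM⟩ := (exists_vecMul_eq_zero_iff
    (M := (Matrix.of fun i => Fin.snoc (A i) 0 : Matrix (Fin (n + 1)) (Fin (n + 1)) ℤ))).2
      (det_eq_zero_of_column_eq_zero (Fin.last n) (by simp))
  have hlA : l ᵥ* A = 0 := by
    ext k
    simpa [vecMul, dotProduct] using congrFun hlM k.castSucc
  exact ⟨l, fun i hi => hl (eq_zero_of_vecMul_eq_zero hind hlA hi), hlA⟩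

/-- The column lattice of `A` has finite index in the orthogonal complement of the relation. -/
lemma exists_mulVec_eq_smul {n : ℕ} {A : Matrix (Fin (n + 1)) (Fin n) ℤ}
    (hind : ∀ i : Fin (n + 1),
      LinearIndependent ℚ (fun j : {j : Fin (n + 1) // j ≠ i} => fun k => (A j.1 k : ℚ)))
    {l : Fin (n + 1) → ℤ} (hl : ∀ i, l i ≠ 0) (hlA : l ᵥ* A = 0) :
    ∃ D : ℤ, 0 < D ∧ ∀ v : Fin (n + 1) → ℤ, l ⬝ᵥ v = 0 → ∃ x, A *ᵥ x = D • v := by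
  set B : Matrix (Fin n) (Fin n) ℤ := A.submatrix Fin.succ id with hB
  have hdet : B.det ≠ 0 := by
    intro h0
    obtain ⟨u, hu, huB⟩ := exists_vecMul_eq_zero_iff.2 h0
    have hcons : (Fin.cons 0 u : Fin (n + 1) → ℤ) = 0 := by
      refine eq_zero_of_vecMul_eq_zero hind (i := 0) ?_ rfl
      ext k
      simpa [vecMul, dotProduct, Fin.sum_univ_succ, hB] using congrFun huB k
    exact hu (funext fun k => by simpa using congrFun hcons k.succ)
  refine ⟨B.det * B.det, mul_self_pos.2 hdet, fun v hv => ?_⟩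
  set x := B.det • (B.adjugate *ᵥ (fun k => v k.succ)) with hx
  have hBx : B *ᵥ x = (B.det * B.det) • (fun k => v k.succ) := by
    rw [hx, mulVec_smul, mulVec_mulVec, mul_adjugate, smul_mulVec, one_mulVec, smul_smul]
  have hsucc : ∀ k : Fin n, (A *ᵥ x) k.succ = B.det * B.det * v k.succ := fun k =>
    congrFun hBx k
  have h0 : l ⬝ᵥ (A *ᵥ x) = 0 := by rw [dotProduct_mulVec, hlA, zero_dotProduct]
  refine ⟨x, ?_⟩
  ext k
  induction k using Fin.cases with
  | succ k => simpa using hsucc k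
  | zero =>
    apply mul_left_cancel₀ (hl 0)
    simp only [dotProduct, Fin.sum_univ_succ, hsucc] at h0 hv
    have : ∑ k : Fin n, l k.succ * (B.det * B.det * v k.succ)
        = B.det * B.det * ∑ k : Fin n, l k.succ * v k.succ := by
      rw [Finset.mul_sum]; exact Finset.sum_congr rfl fun _ _ => by ring
    rw [this] at h0
    simp only [Pi.smul_apply, smul_eq_mul]
    linear_combination h0 - B.det * B.det * hv

/-- Boundedness forces the coefficients of the relation to have a common sign. -/
lemma exists_pos_relation {n : ℕ} {A : Matrix (Fin (n + 1)) (Fin n) ℤ}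
    (hbdd : {x : Fin n → ℝ | ∀ i, (∑ j, (A i j : ℝ) * x j) ≤ 0} = {0})
    (hind : ∀ i : Fin (n + 1),
      LinearIndependent ℚ (fun j : {j : Fin (n + 1) // j ≠ i} => fun k => (A j.1 k : ℚ))) :
    ∃ l : Fin (n + 1) → ℤ, (∀ i, 0 < l i) ∧ l ᵥ* A = 0 := by
  obtain ⟨l, hl, hlA⟩ := exists_relation hind
  obtain ⟨D, hD, hsol⟩ := exists_mulVec_eq_smul hind hl hlA
  have hsame : ∀ i j, 0 < l i → ¬ l j < 0 := by
    intro i j hi hj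
    have hij : i ≠ j := by rintro rfl; omega
    obtain ⟨x, hx⟩ := hsol (Pi.single i (l j) - Pi.single j (l i))
      (by simp [dotProduct_sub, mul_comm])
    have hnonpos : ∀ k, (A *ᵥ x) k ≤ 0 := by
      intro k
      rw [hx]
      refine mul_nonpos_of_nonneg_of_nonpos hD.le ?_
      simp only [Pi.sub_apply, Pi.single_apply]
      split_ifs <;> omega
    have hx0 : (fun k => (x k : ℝ)) ∈ ({0} : Set (Fin n → ℝ)) := by
      rw [← hbdd]
      intro k
      have := hnonpos k
      simp only [mulVec, dotProduct] at this
      beta_reduce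
      exact_mod_cast this
    have hx0' : x = 0 := by
      ext k
      simpa using congrFun hx0 k
    have := congrFun hx i
    simp [hx0', hij, hD.ne', hj.ne] at this
  rcases (hl 0).lt_or_gt with h0 | h0
  · refine ⟨-l, fun i => ?_, by rw [neg_vecMul, hlA, neg_zero]⟩
    have := (hl i).lt_or_gt.resolve_right fun h => hsame i 0 h h0
    simpa using this
  · exact ⟨l, fun i => (hl i).lt_or_gt.resolve_left (hsame 0 i h0), hlA⟩

/-- Weights `w` for which all `w i • e i` agree modulo the column lattice of `A`. -/
lemma exists_weights {n : ℕ} {A : Matrix (Fin (n + 1)) (Fin n) ℤ}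
    (hind : ∀ i : Fin (n + 1),
      LinearIndependent ℚ (fun j : {j : Fin (n + 1) // j ≠ i} => fun k => (A j.1 k : ℚ)))
    {l : Fin (n + 1) → ℤ} (hl : ∀ i, 0 < l i) (hlA : l ᵥ* A = 0) :
    ∃ (P : ℤ) (w : Fin (n + 1) → ℤ), 0 < P ∧ (∀ i, 0 < w i) ∧ (∀ i, l i * w i = P) ∧
      ∀ m : Fin (n + 1) → ℤ, w * m - Pi.single 0 (w 0 * ∑ i, m i) ∈
        LinearMap.range A.mulVecLin := by
  obtain ⟨D, hD, hsol⟩ := exists_mulVec_eq_smul hind (fun i => (hl i).ne') hlA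
  have hprod : ∀ i, l i * ∏ j ∈ Finset.univ.erase i, l j = ∏ j, l j := fun i =>
    Finset.mul_prod_erase _ _ (Finset.mem_univ i)
  set u : Fin (n + 1) → ℤ := fun i => ∏ j ∈ Finset.univ.erase i, l j with hu
  refine ⟨D * ∏ j, l j, D • u, mul_pos hD (Finset.prod_pos fun i _ => hl i),
    fun i => mul_pos hD (Finset.prod_pos fun i _ => hl i), fun i => ?_, fun m => ?_⟩
  · rw [← hprod i]; simp only [hu, Pi.smul_apply, smul_eq_mul]; ring
  · obtain ⟨x, hx⟩ := hsol (u * m - Pi.single 0 (u 0 * ∑ i, m i)) (by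
      rw [dotProduct_sub, dotProduct_single, ← mul_assoc, hprod, Finset.mul_sum, dotProduct,
        ← Finset.sum_sub_distrib]
      refine Finset.sum_eq_zero fun i _ => ?_
      rw [← hprod i, Pi.mul_apply]; ring)
    refine ⟨x, ?_⟩
    rw [mulVecLin_apply, hx, smul_sub, ← Pi.single_smul, smul_mul_assoc]
    simp [mul_assoc]

lemma card_piAntidiag_univ_fin (n k : ℕ) :
    (Finset.piAntidiag (Finset.univ : Finset (Fin (n + 1))) k).card = (k + n).choose n := by
  rw [← Finset.map_sym_eq_piAntidiag, Finset.card_map, Finset.sym_univ, Finset.card_univ,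
    Sym.card_sym_eq_choose, Fintype.card_fin]
  rw [show n + 1 + k - 1 = k + n by omega, ← Nat.choose_symm_add]

/-- The binomial coefficient `(y + n).choose n`, as a polynomial function of `y`. -/
noncomputable def shiftedChoose (n : ℕ) (y : ℚ) : ℚ :=
  (descPochhammer ℚ n).eval (y + n) / n.factorial

lemma shiftedChoose_intCast {n : ℕ} {k : ℤ} (hk : -(n : ℤ) ≤ k) :
    shiftedChoose n k = if 0 ≤ k then
      ((Finset.piAntidiag (Finset.univ : Finset (Fin (n + 1))) k.toNat).card : ℚ) else 0 := by
  obtain ⟨a, ha⟩ := Int.eq_ofNat_of_zero_le (show 0 ≤ k + n by omega)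
  have hcast : (k : ℚ) + n = a := by exact_mod_cast ha
  rw [shiftedChoose, hcast, ← Nat.cast_choose_eq_descPochhammer_div]
  split_ifs with h
  · rw [card_piAntidiag_univ_fin, show k.toNat + n = a by omega]
  · rw [Nat.choose_eq_zero_of_lt (by omega), Nat.cast_zero]

lemma shiftedChoose_reflect (n : ℕ) (y : ℚ) :
    shiftedChoose n (-y - (n + 1)) = (-1) ^ n * shiftedChoose n y := by
  rw [shiftedChoose, shiftedChoose, descPochhammer_eval_eq_ascPochhammer,
    show -y - (n + 1) + n - n + 1 = -(y + n) by ring,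
    ascPochhammer_eval_neg_eq_descPochhammer, mul_div_assoc]

section LatticeCount

variable {n : ℕ} {Λ : Submodule ℤ (Fin (n + 1) → ℤ)} {l w : Fin (n + 1) → ℤ} {P : ℤ}

/-- The residues `r` modulo `w` that occur among the points of `t + Λ`. -/
def IsAdmissible (Λ : Submodule ℤ (Fin (n + 1) → ℤ)) (w r t : Fin (n + 1) → ℤ) : Prop :=
  ∃ k : ℤ, r + Pi.single 0 (w 0 * k) - t ∈ Λ

/-- The integer vectors `r` with `c ≤ r i < c + w i` for all `i`. -/
noncomputable def residueBox (w : Fin (n + 1) → ℤ) (c : ℤ) : Finset (Fin (n + 1) → ℤ) :=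
  Fintype.piFinset fun i => Finset.Ico c (c + w i)

lemma mem_residueBox {c : ℤ} {r : Fin (n + 1) → ℤ} :
    r ∈ residueBox w c ↔ ∀ i, c ≤ r i ∧ r i < c + w i := by
  simp [residueBox]

open Classical in
/-- The quasipolynomial counting the points `s` of `t + Λ` with `c ≤ s`. -/
noncomputable def latticeCount (Λ : Submodule ℤ (Fin (n + 1) → ℤ)) (l w : Fin (n + 1) → ℤ)
    (P c : ℤ) (t : Fin (n + 1) → ℤ) : ℚ :=
  ∑ r ∈ residueBox w c, if IsAdmissible Λ w r t then
    shiftedChoose n (((l ⬝ᵥ t - l ⬝ᵥ r : ℤ) : ℚ) / P) else 0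

lemma dotProduct_eq_of_mem (hP : ∀ i, l i * w i = P) (hΛ : ∀ v ∈ Λ, l ⬝ᵥ v = 0)
    {r t : Fin (n + 1) → ℤ} {k : ℤ} (h : r + Pi.single 0 (w 0 * k) - t ∈ Λ) :
    l ⬝ᵥ t - l ⬝ᵥ r = P * k := by
  have := hΛ _ h
  rw [dotProduct_sub, dotProduct_add, dotProduct_single, ← mul_assoc, hP] at this
  omega

lemma add_mul_sub_mem_iff (hw : ∀ m : Fin (n + 1) → ℤ, w * m - Pi.single 0 (w 0 * ∑ i, m i) ∈ Λ)
    (r t m : Fin (n + 1) → ℤ) :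
    r + w * m - t ∈ Λ ↔ r + Pi.single 0 (w 0 * ∑ i, m i) - t ∈ Λ := by
  rw [show r + w * m - t = r + Pi.single 0 (w 0 * ∑ i, m i) - t
      + (w * m - Pi.single 0 (w 0 * ∑ i, m i)) by abel]
  exact Submodule.add_mem_iff_left Λ (hw m)

lemma residue_emod_ediv {a c r m : ℤ} (h : c ≤ r ∧ r < c + a) :
    (r + a * m - c) % a = r - c ∧ (r + a * m - c) / a = m := by
  have ha : 0 < a := by omega
  rw [show r + a * m - c = r - c + a * m by ring, Int.add_mul_emod_self_left,
    Int.add_mul_ediv_left _ _ ha.ne', Int.ediv_eq_zero_of_lt (by omega) (by omega), zero_add]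
  exact ⟨Int.emod_eq_of_lt (by omega) (by omega), rfl⟩

open Classical in
lemma ncard_eq_latticeCount (hl : ∀ i, 0 < l i) (hwpos : ∀ i, 0 < w i) (hPpos : 0 < P)
    (hP : ∀ i, l i * w i = P) (hΛ : ∀ v ∈ Λ, l ⬝ᵥ v = 0)
    (hw : ∀ m : Fin (n + 1) → ℤ, w * m - Pi.single 0 (w 0 * ∑ i, m i) ∈ Λ)
    {c : ℤ} (hc : c ≤ 1) {t : Fin (n + 1) → ℤ} (ht : 0 < l ⬝ᵥ t) :
    ({s : Fin (n + 1) → ℤ | (∀ i, c ≤ s i) ∧ s - t ∈ Λ}.ncard : ℚ) =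
      latticeCount Λ l w P c t := by
  let K : (Fin (n + 1) → ℤ) → ℤ := fun r => (l ⬝ᵥ t - l ⬝ᵥ r) / P
  have hK : ∀ {r : Fin (n + 1) → ℤ} {k : ℤ}, r + Pi.single 0 (w 0 * k) - t ∈ Λ → K r = k :=
    fun h => by simp only [K, dotProduct_eq_of_mem hP hΛ h, Int.mul_ediv_cancel_left _ hPpos.ne']
  let T : Finset (Σ _ : Fin (n + 1) → ℤ, Fin (n + 1) → ℕ) :=
    ((residueBox w c).filter (IsAdmissible Λ w · t)).sigma fun r =>
      if 0 ≤ K r then Finset.piAntidiag Finset.univ (K r).toNat else ∅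
  let f : (Σ _ : Fin (n + 1) → ℤ, Fin (n + 1) → ℕ) → Fin (n + 1) → ℤ :=
    fun x => x.1 + w * (fun i => (x.2 i : ℤ))
  have hmem : ∀ r m, (⟨r, m⟩ : Σ _ : Fin (n + 1) → ℤ, Fin (n + 1) → ℕ) ∈ T ↔
      r ∈ residueBox w c ∧ IsAdmissible Λ w r t ∧ K r = ∑ i, (m i : ℤ) := by
    intro r m
    have hcast : ((∑ i, m i : ℕ) : ℤ) = ∑ i, (m i : ℤ) := by push_cast; rfl
    simp only [T, Finset.mem_sigma, Finset.mem_filter, and_assoc]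
    refine and_congr_right fun _ => and_congr_right fun _ => ?_
    generalize K r = k
    split_ifs with h
    · simp only [Finset.mem_piAntidiag, Finset.mem_univ, implies_true, and_true]
      change ∑ i, m i = k.toNat ↔ _
      omega
    · simp only [Finset.notMem_empty, false_iff]
      rintro rfl
      exact h (by positivity)
  have hinj : Set.InjOn f T := by
    rintro ⟨r, m⟩ hx ⟨r', m'⟩ hx' h
    have hr := mem_residueBox.1 ((hmem r m).1 hx).1
    have hr' := mem_residueBox.1 ((hmem r' m').1 hx').1
    have key : ∀ i, r i = r' i ∧ m i = m' i := fun i => by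
      have hi : r i + w i * m i = r' i + w i * m' i := congrFun h i
      have h1 := residue_emod_ediv (m := m i) (hr i)
      have h2 := residue_emod_ediv (m := m' i) (hr' i)
      rw [hi] at h1
      omega
    obtain rfl : r = r' := funext fun i => (key i).1
    obtain rfl : m = m' := funext fun i => (key i).2
    rfl
  have himage : {s : Fin (n + 1) → ℤ | (∀ i, c ≤ s i) ∧ s - t ∈ Λ} = T.image f := by
    ext s
    simp only [Set.mem_ofPred_eq, Finset.coe_image, Set.mem_image, Finset.mem_coe]
    constructor
    · rintro ⟨hs, hst⟩
      set m : Fin (n + 1) → ℕ := fun i => ((s i - c) / w i).toNat with hm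
      set r : Fin (n + 1) → ℤ := fun i => c + (s i - c) % w i with hr
      have hmcast : ∀ i, (m i : ℤ) = (s i - c) / w i := fun i =>
        Int.toNat_of_nonneg (Int.ediv_nonneg (by linarith [hs i]) (hwpos i).le)
      have hs' : f ⟨r, m⟩ = s := by
        ext i
        simp only [f, Pi.add_apply, Pi.mul_apply, hmcast, hr]
        linarith [Int.emod_add_mul_ediv (s i - c) (w i)]
      have hr0 := (add_mul_sub_mem_iff hw r t (fun i => (m i : ℤ))).1
        (by rw [← hs'] at hst; exact hst)
      refine ⟨⟨r, m⟩, (hmem r m).2 ⟨mem_residueBox.2 fun i => ?_, ⟨_, hr0⟩, hK hr0⟩, hs'⟩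
      have h1 := Int.emod_nonneg (s i - c) (hwpos i).ne'
      have h2 := Int.emod_lt_of_pos (s i - c) (hwpos i)
      simp only [hr]
      omega
    · rintro ⟨⟨r, m⟩, hx, rfl⟩
      obtain ⟨hr, ⟨k, hk⟩, hKm⟩ := (hmem r m).1 hx
      refine ⟨fun i => ?_, ?_⟩
      · have := mul_nonneg (hwpos i).le (Int.natCast_nonneg (m i))
        have := (mem_residueBox.1 hr i).1
        simp only [f, Pi.add_apply, Pi.mul_apply]
        omega
      · refine (add_mul_sub_mem_iff hw r t _).2 ?_
        rwa [← hKm, hK hk]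
  rw [himage, Set.ncard_coe_finset, Finset.card_image_of_injOn hinj, Finset.card_sigma,
    Finset.sum_filter, latticeCount, Nat.cast_sum]
  refine Finset.sum_congr rfl fun r hr => ?_
  by_cases h : IsAdmissible Λ w r t
  · rw [if_pos h, if_pos h]
    obtain ⟨k, hk⟩ := h
    have hlr := dotProduct_eq_of_mem hP hΛ hk
    have hle : l ⬝ᵥ r ≤ P * (n + 1) := by
      calc l ⬝ᵥ r ≤ ∑ _i : Fin (n + 1), P := Finset.sum_le_sum fun i _ => by
            rw [← hP i]
            exact mul_le_mul_of_nonneg_left (by have := mem_residueBox.1 hr i; omega) (hl i).le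
        _ = P * (n + 1) := by simp [mul_comm]
    have hk' : -(n : ℤ) ≤ k := by
      have : 0 < P * (k + (n + 1)) := by linarith
      have := pos_of_mul_pos_right this hPpos.le
      omega
    rw [hlr, hK hk, Int.cast_mul, mul_div_cancel_left₀ _ (by exact_mod_cast hPpos.ne'),
      shiftedChoose_intCast hk']
    split_ifs <;> simp
  · rw [if_neg h, if_neg h, Nat.cast_zero]

lemma latticeCount_zero_eq (hPpos : 0 < P)
    (hP : ∀ i, l i * w i = P)
    (hw : ∀ m : Fin (n + 1) → ℤ, w * m - Pi.single 0 (w 0 * ∑ i, m i) ∈ Λ)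
    (t : Fin (n + 1) → ℤ) :
    latticeCount Λ l w P 0 t = (-1) ^ n * latticeCount Λ l w P 1 (-t) := by
  classical
  have hadm : ∀ r t, IsAdmissible Λ w r t → IsAdmissible Λ w (w - r) (-t) := by
    rintro r t ⟨k, hk⟩
    refine ⟨-(n + 1 : ℤ) - k, ?_⟩
    have h1 := Λ.sub_mem (hw 1) hk
    convert h1 using 1
    simp only [Pi.one_apply, Finset.sum_const, Finset.card_univ, Fintype.card_fin, nsmul_eq_mul,
      mul_one, mul_sub, mul_neg, Pi.single_sub, Pi.single_neg]
    push_cast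
    abel
  have hPQ : (P : ℚ) ≠ 0 := by exact_mod_cast hPpos.ne'
  rw [latticeCount, latticeCount, Finset.mul_sum]
  refine Finset.sum_nbij' (w - ·) (w - ·) ?_ ?_ (by simp) (by simp) ?_
  · intro r hr
    simp only [mem_residueBox, Pi.sub_apply] at hr ⊢
    intro i; have := hr i; omega
  · intro r hr
    simp only [mem_residueBox, Pi.sub_apply] at hr ⊢
    intro i; have := hr i; omega
  · intro r _
    have hiff : IsAdmissible Λ w (w - r) (-t) ↔ IsAdmissible Λ w r t :=
      ⟨fun h => by simpa using hadm _ _ h, hadm r t⟩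
    rw [if_congr hiff rfl rfl, mul_ite, mul_zero]
    refine if_congr Iff.rfl ?_ rfl
    have hlw : l ⬝ᵥ w = P * (n + 1) := by
      simp [dotProduct, hP, mul_comm]
    rw [← shiftedChoose_reflect]
    congr 1
    rw [dotProduct_neg, dotProduct_sub, hlw]
    push_cast
    field_simp
    ring

lemma IsAdmissible.of_modEq (hP : ∀ i, l i * w i = P)
    (hw : ∀ m : Fin (n + 1) → ℤ, w * m - Pi.single 0 (w 0 * ∑ i, m i) ∈ Λ)
    {r t t' : Fin (n + 1) → ℤ} (htt' : ∀ i, t i ≡ t' i [ZMOD P]) (h : IsAdmissible Λ w r t) :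
    IsAdmissible Λ w r t' := by
  choose u hu using fun i => (htt' i).dvd
  obtain ⟨k, hk⟩ := h
  refine ⟨k + ∑ i, l i * u i, ?_⟩
  have h1 := Λ.sub_mem hk (hw (l * u))
  have ht' : w * (l * u) = t' - t := by
    ext i
    simp only [Pi.mul_apply, Pi.sub_apply, hu, ← hP i]
    ring
  convert h1 using 1
  rw [ht', mul_add, Pi.single_add]
  simp only [Pi.mul_apply]
  abel

open Classical in
/-- The polynomial agreeing with `latticeCount` on the residue class of `a`. -/
noncomputable def latticeCountPolynomial (Λ : Submodule ℤ (Fin (n + 1) → ℤ))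
    (l w : Fin (n + 1) → ℤ) (P c : ℤ) (a : Fin (n + 1) → ℤ) : MvPolynomial (Fin (n + 1)) ℚ :=
  ∑ r ∈ residueBox w c, if IsAdmissible Λ w r a then
    MvPolynomial.C (n.factorial : ℚ)⁻¹ * Polynomial.aeval
      (MvPolynomial.C (P : ℚ)⁻¹ * (∑ i, MvPolynomial.C (l i : ℚ) * MvPolynomial.X i
        - MvPolynomial.C ((l ⬝ᵥ r : ℤ) : ℚ)) + MvPolynomial.C (n : ℚ)) (descPochhammer ℚ n) else 0

lemma eval_latticeCountPolynomial (hP : ∀ i, l i * w i = P)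
    (hw : ∀ m : Fin (n + 1) → ℤ, w * m - Pi.single 0 (w 0 * ∑ i, m i) ∈ Λ)
    {c : ℤ} {a t : Fin (n + 1) → ℤ} (hat : ∀ i, a i ≡ t i [ZMOD P]) :
    MvPolynomial.eval (fun i => (t i : ℚ)) (latticeCountPolynomial Λ l w P c a) =
      latticeCount Λ l w P c t := by
  classical
  rw [latticeCountPolynomial, latticeCount, map_sum]
  refine Finset.sum_congr rfl fun r _ => ?_
  have hiff : IsAdmissible Λ w r a ↔ IsAdmissible Λ w r t :=
    ⟨.of_modEq hP hw hat, .of_modEq hP hw fun i => (hat i).symm⟩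
  rw [if_congr hiff rfl rfl]
  split_ifs
  · rw [map_mul, MvPolynomial.eval_C, ← MvPolynomial.coe_aeval_eq_eval]
    simp only [RingHom.coe_coe]
    rw [← Polynomial.aeval_algHom_apply, Polynomial.coe_aeval_eq_eval, shiftedChoose,
      div_eq_inv_mul]
    simp [MvPolynomial.aeval_def, dotProduct, div_eq_inv_mul]
  · simp

end LatticeCount

/-- Lattice points `x` with `A x + c ≤ t` correspond to the slack vectors in `t + A ℤⁿ`. -/
lemma ncard_setOf_le_sub {n : ℕ} {A : Matrix (Fin (n + 1)) (Fin n) ℤ}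
    (hA : Function.Injective A.mulVec) (t : Fin (n + 1) → ℤ) (c : ℤ) :
    {x : Fin n → ℤ | ∀ i, c ≤ t i - (A *ᵥ x) i}.ncard =
      {s : Fin (n + 1) → ℤ | (∀ i, c ≤ s i) ∧ s - t ∈ LinearMap.range A.mulVecLin}.ncard := by
  rw [← Set.ncard_image_of_injective (f := fun x => t - A *ᵥ x) _
    fun x y h => hA (sub_right_injective h)]
  congr 1
  ext s
  simp only [Set.mem_image, Set.mem_ofPred_eq, LinearMap.mem_range, mulVecLin_apply]
  constructor
  · rintro ⟨x, hx, rfl⟩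
    exact ⟨hx, -x, by rw [mulVec_neg]; abel⟩
  · rintro ⟨hs, x, hx⟩
    have hs' : t - A *ᵥ (-x) = s := by rw [mulVec_neg, hx]; abel
    exact ⟨-x, fun i => by rw [← Pi.sub_apply, hs']; exact hs i, hs'⟩

lemma interior_setOf_forall_sum_mul_le {ι κ : Type*} [Fintype κ] [Finite ι] {a : ι → κ → ℝ}
    (ha : ∀ i, a i ≠ 0) (b : ι → ℝ) :
    interior {x : κ → ℝ | ∀ i, ∑ j, a i j * x j ≤ b i} = {x | ∀ i, ∑ j, a i j * x j < b i} := by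
  rw [Set.ofPred_forall, interior_iInter_of_finite, Set.ofPred_forall]
  refine Set.iInter_congr fun i => ?_
  let f : (κ → ℝ) →ₗ[ℝ] ℝ := dotProductBilin ℝ ℝ (a i)
  have hf : f ≠ 0 := fun h => ha i (dotProduct_self_eq_zero.1 (LinearMap.congr_fun h (a i)))
  have := (f.isOpenMap_of_finiteDimensional
    (LinearMap.surjective hf)).preimage_interior_eq_interior_preimage
      f.continuous_of_finiteDimensional (Set.Iic (b i))
  rw [interior_Iic] at this
  exact this.symm

/-- **Ehrhart-type reciprocity for vector-dilated simplices.**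
Let `A` be an `(n+1) × n` integer matrix with `{x : A x ≤ 0} = {0}` and every `n` of
whose `n+1` rows are linearly independent over `ℚ`.  For `t ∈ ℤ^{n+1}` let
`S^(t) = {x ∈ ℝⁿ : A x ≤ t}`.  Then there are a positive integer `p` and a family of
polynomials `q_r ∈ ℚ[x₁,…,x_{n+1}]`, indexed by `r ∈ (ℤ/p)^{n+1}`, such that for
every `t` for which `S^(t)` has nonempty interior, the number of lattice points in
the interior of `S^(t)` is `q_{t mod p}(t)` and the number of lattice points in
`S^(t)` is `(-1)^n ⬝ q_{(-t) mod p}(-t)`. -/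
theorem vector_dilated_simplex_reciprocity
    (n : ℕ) (A : Matrix (Fin (n + 1)) (Fin n) ℤ)
    (hbdd : {x : Fin n → ℝ | ∀ i, (∑ j, (A i j : ℝ) * x j) ≤ 0} = {0})
    (hind : ∀ i : Fin (n + 1),
      LinearIndependent ℚ (fun j : {j : Fin (n + 1) // j ≠ i} => fun k => (A j.1 k : ℚ))) :
    ∃ p : ℕ, 0 < p ∧
      ∃ q : (Fin (n + 1) → ZMod p) → MvPolynomial (Fin (n + 1)) ℚ,
        ∀ t : Fin (n + 1) → ℤ,
          (interior {x : Fin n → ℝ | ∀ i, (∑ j, (A i j : ℝ) * x j) ≤ (t i : ℝ)}).Nonempty →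
          (({x : Fin n → ℤ |
              (fun i => (x i : ℝ)) ∈
                interior {x : Fin n → ℝ | ∀ i, (∑ j, (A i j : ℝ) * x j) ≤ (t i : ℝ)}}.ncard : ℚ)
            = MvPolynomial.eval (fun i => (t i : ℚ)) (q fun i => (t i : ZMod p))) ∧
          (({x : Fin n → ℤ | ∀ i, (∑ j, A i j * x j) ≤ t i}.ncard : ℚ)
            = (-1) ^ n *
                MvPolynomial.eval (fun i => (-(t i) : ℚ)) (q fun i => (-(t i) : ZMod p))) := by
  rcases Nat.eq_zero_or_pos n with rfl | hn
  · refine ⟨1, one_pos, fun _ => 1, fun t ht => ?_⟩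
    obtain ⟨y, hy⟩ := ht
    have ht0 : ∀ i, 0 ≤ t i := fun i => by
      have h := interior_subset hy i
      simp only [Finset.univ_eq_empty, Finset.sum_empty] at h
      exact_mod_cast h
    constructor
    · rw [Set.eq_univ_of_forall (s := {x : Fin 0 → ℤ | _})
        fun x => by simpa only [Set.mem_ofPred_eq, Subsingleton.elim (fun i => (x i : ℝ)) y] using hy]
      simp
    · rw [Set.eq_univ_of_forall (s := {x : Fin 0 → ℤ | _}) fun x => by simpa using ht0]
      simp
  obtain ⟨l, hl, hlA⟩ := exists_pos_relation hbdd hind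
  obtain ⟨P, w, hPpos, hwpos, hP, hw⟩ := exists_weights hind hl hlA
  have hΛ : ∀ v ∈ LinearMap.range A.mulVecLin, l ⬝ᵥ v = 0 := by
    rintro _ ⟨x, rfl⟩
    rw [mulVecLin_apply, dotProduct_mulVec, hlA, zero_dotProduct]
  have hrow : ∀ i, (fun j => (A i j : ℝ)) ≠ 0 := by
    intro i hi
    have : Nontrivial (Fin (n + 1)) := Fin.nontrivial_iff_two_le.2 (by omega)
    obtain ⟨i', hi'⟩ := exists_ne i
    refine (hind i').ne_zero ⟨i, hi'.symm⟩ (funext fun k => ?_)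
    have := congrFun hi k
    simp only [Pi.zero_apply, Int.cast_eq_zero] at this
    simp [this]
  have hinj : Function.Injective A.mulVec := by
    refine (injective_iff_map_eq_zero A.mulVecLin).2 fun x hx => ?_
    have hx0 : (fun k => (x k : ℝ)) ∈ ({0} : Set (Fin n → ℝ)) := by
      rw [← hbdd]
      intro k
      have := (congrFun hx k).le
      simp only [mulVecLin_apply, mulVec, dotProduct, Pi.zero_apply] at this
      beta_reduce
      exact_mod_cast this
    ext k
    simpa using congrFun hx0 k
  obtain ⟨p, rfl⟩ := Int.eq_ofNat_of_zero_le hPpos.le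
  have hp : 0 < p := by omega
  have : NeZero p := ⟨hp.ne'⟩
  refine ⟨p, hp, fun ρ => latticeCountPolynomial (LinearMap.range A.mulVecLin) l w p 1
    fun i => (ρ i).val, fun t ht => ?_⟩
  have hval : ∀ u : Fin (n + 1) → ℤ, ∀ i, (((u i : ZMod p).val : ℕ) : ℤ) ≡ u i [ZMOD (p : ℤ)] :=
    fun u i => by rw [ZMod.val_intCast]; exact Int.mod_modEq _ _
  rw [interior_setOf_forall_sum_mul_le hrow] at ht ⊢
  have hpos : 0 < l ⬝ᵥ t := by
    obtain ⟨y, hy⟩ := ht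
    have h0 : ∑ i, (l i : ℝ) * ∑ j, (A i j : ℝ) * y j = 0 := by
      simp only [Finset.mul_sum]
      rw [Finset.sum_comm]
      refine Finset.sum_eq_zero fun j _ => ?_
      have hj : ∑ i, (l i : ℝ) * (A i j : ℝ) = 0 := by exact_mod_cast congrFun hlA j
      simp only [← mul_assoc, ← Finset.sum_mul, hj, zero_mul]
    have hlt : ∑ i, (l i : ℝ) * ∑ j, (A i j : ℝ) * y j < ∑ i, (l i : ℝ) * (t i : ℝ) :=
      Finset.sum_lt_sum_of_nonempty Finset.univ_nonempty fun i _ =>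
        mul_lt_mul_of_pos_left (hy i) (by exact_mod_cast hl i)
    rw [h0] at hlt
    simp only [dotProduct]
    exact_mod_cast hlt
  constructor
  · rw [eval_latticeCountPolynomial hP hw (hval t),
      ← ncard_eq_latticeCount hl hwpos hPpos hP hΛ hw le_rfl hpos, ← ncard_setOf_le_sub hinj]
    congr 2
    ext x
    refine forall_congr' fun i => ?_
    simp only [mulVec, dotProduct]
    rw [show (1 : ℤ) ≤ t i - ∑ j, A i j * x j ↔ ∑ j, A i j * x j < t i by omega]
    exact_mod_cast Iff.rfl
  · have heval := eval_latticeCountPolynomial (c := 1) hP hw (hval (-t))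
    simp only [Pi.neg_apply, Int.cast_neg] at heval
    rw [heval, ← latticeCount_zero_eq hPpos hP hw,
      ← ncard_eq_latticeCount hl hwpos hPpos hP hΛ hw zero_le_one hpos, ← ncard_setOf_le_sub hinj]
    simp only [sub_nonneg, mulVec, dotProduct]
end
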